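/- Let ∅ ≠ E ⊂ X be a closed and porous set, let α ∈ ℝ, let 1 < p < ∞, and set w = δ_E^{-α}. Then w belongs to the Muckenhoupt class A_p if and only if (1−p)·codim_A(E) < α < codim_A(E). -/

import Mathlib

open MeasureTheory Metric Set
open scoped ENNReal NNReal

namespace ApDistance

noncomputable section

variable {X : Type*} [MetricSpace X] [MeasurableSpace X] [BorelSpace X]

/-- All balls of positive radius have positive and finite measure. -/
def BallsPosFinite (μ : Measure X) : Prop :=
  ∀ (x : X) (r : ℝ), 0 < r → 0 < μ (ball x r) ∧ μ (ball x r) < ∞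

/-- The measure `μ` is doubling with constant `C`. -/
def DoublingWith (μ : Measure X) (C : ℝ) : Prop :=
  ∀ (x : X) (r : ℝ), 0 < r → μ (ball x (2 * r)) ≤ ENNReal.ofReal C * μ (ball x r)

/-- The measure `μ` is doubling. -/
def Doubling (μ : Measure X) : Prop :=
  ∃ C : ℝ, 0 < C ∧ DoublingWith μ C

/-- The (quantitative) reverse doubling condition with exponent `η`. -/
def ReverseDoubling (μ : Measure X) (η : ℝ) : Prop :=
  ∃ C : ℝ, 0 < C ∧ ∀ (x y : X) (r R : ℝ), 0 < r → 0 < R → ball y r ⊆ ball x R →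
    μ (ball y r) ≤ ENNReal.ofReal (C * (r / R) ^ η) * μ (ball x R)

/-- Standing assumptions (S1)-(S2): `X` is unbounded, points have measure zero,
and all annuli are nonempty. -/
def StandingAssumptions (μ : Measure X) : Prop :=
  ¬ Bornology.IsBounded (univ : Set X) ∧ (∀ x : X, μ {x} = 0) ∧
    ∀ (x : X) (r R : ℝ), 0 < r → r < R → (ball x R \ ball x r).Nonempty

/-- Ahlfors `Q`-regularity of the metric measure space. -/
def AhlforsRegular (μ : Measure X) (Q : ℝ) : Prop :=
  ∃ C : ℝ, 1 ≤ C ∧ ∀ (x : X) (r : ℝ), 0 < r → ENNReal.ofReal r < EMetric.diam (univ : Set X) →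
    ENNReal.ofReal (C⁻¹ * r ^ Q) ≤ μ (ball x r) ∧ μ (ball x r) ≤ ENNReal.ofReal (C * r ^ Q)

/-- The set of admissible exponents in the definition of the (upper) Assouad dimension:
`E ∩ B(x,R)` can be covered by at most `C (R/r)^s` balls of radius `r`. -/
def assouadDimBddSet (E : Set X) : Set ℝ :=
  {s : ℝ | 0 ≤ s ∧ ∃ C : ℝ, 1 ≤ C ∧ ∀ x ∈ E, ∀ r R : ℝ, 0 < r → r < R →
    ENNReal.ofReal R < 2 * EMetric.diam (univ : Set X) →
    ∃ F : Finset X, (F.card : ℝ) ≤ C * (R / r) ^ s ∧ E ∩ ball x R ⊆ ⋃ y ∈ F, ball y r}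

/-- The (upper) Assouad dimension of a set `E`. -/
def assouadDim (E : Set X) : ℝ := sInf (assouadDimBddSet E)

/-- The set of admissible exponents in the definition of the lower Assouad codimension. -/
def assouadCodimBddSet (μ : Measure X) (E : Set X) : Set ℝ :=
  {ρ : ℝ | 0 ≤ ρ ∧ ∃ C : ℝ, 1 ≤ C ∧ ∀ x ∈ E, ∀ r R : ℝ, 0 < r → r < R →
    ENNReal.ofReal R < 2 * EMetric.diam (univ : Set X) →
    μ ({y : X | infDist y E < r} ∩ ball x R) ≤
      ENNReal.ofReal (C * (r / R) ^ ρ) * μ (ball x R)}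

/-- The lower Assouad codimension of a set `E` with respect to `μ`. -/
def assouadCodim (μ : Measure X) (E : Set X) : ℝ := sSup (assouadCodimBddSet μ E)

/-- Porosity of a set `E ⊆ X`. -/
def IsPorous (E : Set X) : Prop :=
  ∃ c : ℝ, 0 < c ∧ c < 1 ∧ ∀ x ∈ E, ∀ r : ℝ, 0 < r →
    ENNReal.ofReal r < 2 * EMetric.diam (univ : Set X) →
    ∃ y : X, ball y (c * r) ⊆ ball x r \ E

/-- A weight: measurable, a.e. positive and finite, locally integrable on balls. -/
def IsWeight (μ : Measure X) (w : X → ℝ≥0∞) : Prop :=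
  Measurable w ∧ (∀ᵐ x ∂μ, 0 < w x ∧ w x ≠ ∞) ∧
    ∀ (x : X) (r : ℝ), 0 < r → ∫⁻ y in ball x r, w y ∂μ ≠ ∞

/-- Membership in the Muckenhoupt class `A_p`, `1 < p < ∞`. -/
def MemAp (μ : Measure X) (w : X → ℝ≥0∞) (p : ℝ) : Prop :=
  IsWeight μ w ∧ ∃ A : ℝ, 0 < A ∧ ∀ (x : X) (r : ℝ), 0 < r →
    ((∫⁻ y in ball x r, w y ∂μ) / μ (ball x r)) *
      ((∫⁻ y in ball x r, w y ^ (-(1 / (p - 1))) ∂μ) / μ (ball x r)) ^ (p - 1) ≤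
      ENNReal.ofReal A

/-- Membership in the Muckenhoupt class `A_1`. -/
def MemA1 (μ : Measure X) (w : X → ℝ≥0∞) : Prop :=
  IsWeight μ w ∧ ∃ A : ℝ, 0 < A ∧ ∀ (x : X) (r : ℝ), 0 < r →
    ((∫⁻ y in ball x r, w y ∂μ) / μ (ball x r)) *
      essSup (fun y => (w y)⁻¹) (μ.restrict (ball x r)) ≤ ENNReal.ofReal A

/-- Membership in the Muckenhoupt class `A_∞`. -/
def MemAinfty (μ : Measure X) (w : X → ℝ≥0∞) : Prop :=
  IsWeight μ w ∧ ∃ C d : ℝ, 0 < C ∧ 0 < d ∧ ∀ (x : X) (r : ℝ), 0 < r →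
    ∀ F : Set X, MeasurableSet F → F ⊆ ball x r →
      ∫⁻ y in F, w y ∂μ ≤
        ENNReal.ofReal C * (μ F / μ (ball x r)) ^ d * ∫⁻ y in ball x r, w y ∂μ

/-- The weight `w = δ_E^{-α} = dist(·,E)^{-α}` (with values in `ℝ≥0∞`). -/
def distWeight (E : Set X) (α : ℝ) : X → ℝ≥0∞ :=
  fun x => ENNReal.ofReal (infDist x E) ^ (-α)

/-- The Aikawa condition with exponent `α` and constant `C`. -/
def AikawaCondition (μ : Measure X) (E : Set X) (α C : ℝ) : Prop :=
  ∀ x ∈ E, ∀ r : ℝ, 0 < r → ENNReal.ofReal r < 2 * EMetric.diam (univ : Set X) →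
    ∫⁻ y in ball x r, ENNReal.ofReal (infDist y E) ^ (-α) ∂μ ≤
      ENNReal.ofReal (C * r ^ (-α)) * μ (ball x r)

/-- The Riesz potential `I_s f`. -/
def rieszPotential (μ : Measure X) (s : ℝ) (f : X → ℝ≥0∞) (x : X) : ℝ≥0∞ :=
  ∫⁻ y, f y * ENNReal.ofReal (dist x y ^ s) / μ (ball x (dist x y)) ∂μ

/-- `Lip_0(X)`: Lipschitz functions vanishing outside some ball. -/
def MemLip0 (f : X → ℝ) : Prop :=
  (∃ K : ℝ≥0, LipschitzWith K f) ∧ ∃ (x : X) (r : ℝ), ∀ y : X, y ∉ ball x r → f y = 0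

/-- The `λ`-chain condition. -/
def ChainCondition (X : Type*) [MetricSpace X] (lam : ℝ) : Prop :=
  ∃ M : ℝ, 1 ≤ M ∧ ∀ (x : X) (r R : ℝ), 0 < r → r < R →
    ∃ (k : ℕ) (c : ℕ → X) (ρ : ℕ → ℝ),
      (∀ i ≤ k, 0 < ρ i) ∧
      ball (c 0) (lam * ρ 0) ⊆ (ball x R)ᶜ ∧
      ball (c k) (lam * ρ k) ⊆ ball x r ∧
      (∀ i ≤ k,
        M⁻¹ * Metric.diam (ball (c i) (lam * ρ i)) ≤ infDist x (ball (c i) (lam * ρ i)) ∧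
        infDist x (ball (c i) (lam * ρ i)) ≤ M * Metric.diam (ball (c i) (lam * ρ i))) ∧
      (∀ i < k, ∃ (z : X) (t : ℝ), 0 < t ∧
        ball z t ⊆ ball (c i) (ρ i) ∩ ball (c (i + 1)) (ρ (i + 1)) ∧
        ball (c i) (ρ i) ∪ ball (c (i + 1)) (ρ (i + 1)) ⊆ ball z (M * t)) ∧
      (∀ y : X, (({i : ℕ | i ≤ k ∧ y ∈ ball (c i) (lam * ρ i)}).ncard : ℝ) ≤ M)

/-- The inner integral appearing in fractional Hardy–Sobolev inequalities:
`y ↦ ∫_X |f(y)-f(z)|^t / (d(y,z)^{st} μ(B(y,d(y,z)))) dμ(z)`. -/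
def fracEnergyKernel (μ : Measure X) (s t : ℝ) (f : X → ℝ) (y : X) : ℝ≥0∞ :=
  ∫⁻ z, ENNReal.ofReal (|f y - f z| ^ t) /
    (ENNReal.ofReal (dist y z ^ (s * t)) * μ (ball y (dist y z))) ∂μ


set_option linter.unusedSectionVars false
set_option linter.deprecated false

def Adm (X : Type*) [MetricSpace X] (r : ℝ) : Prop :=
  ENNReal.ofReal r < 2 * EMetric.diam (univ : Set X)

lemma Adm.mono {r s : ℝ} (h : Adm X s) (hrs : r ≤ s) : Adm X r :=
  lt_of_le_of_lt (ENNReal.ofReal_le_ofReal hrs) h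

lemma exists_adm [Nontrivial X] (x : X) (r : ℝ) (hr : 0 < r) :
    ∃ t : ℝ, 0 < t ∧ t ≤ r ∧ Adm X t ∧ ball x t = ball x r ∧
      ∀ s, s ≤ r → Adm X s → s / 2 ≤ t := by
  by_cases h : Adm X r
  · refine ⟨r, hr, le_rfl, h, rfl, fun s hs _ => ?_⟩
    linarith
  · unfold Adm at h
    rw [not_lt] at h
    set d := EMetric.diam (univ : Set X) with hd
    have hdtop : d ≠ ∞ := by
      intro h'
      rw [h'] at h
      simp at h
    have hdpos : 0 < d := by
      obtain ⟨a, b, hab⟩ := exists_pair_ne X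
      exact lt_of_lt_of_le (edist_pos.2 hab) (EMetric.edist_le_diam_of_mem (mem_univ a) (mem_univ b))
    have hdr : 0 < d.toReal := ENNReal.toReal_pos hdpos.ne' hdtop
    have hde : d = ENNReal.ofReal d.toReal := (ENNReal.ofReal_toReal hdtop).symm
    have h2 : (2 : ℝ≥0∞) * d = ENNReal.ofReal (2 * d.toReal) := by
      rw [ENNReal.ofReal_mul (by norm_num), ← hde]; simp
    have hle : 2 * d.toReal ≤ r := by
      rw [h2] at h
      exact (ENNReal.ofReal_le_ofReal_iff hr.le).1 h
    have hdist : ∀ y : X, dist y x ≤ d.toReal := by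
      intro y
      rw [dist_edist]
      exact ENNReal.toReal_mono hdtop (EMetric.edist_le_diam_of_mem (mem_univ _) (mem_univ _))
    refine ⟨3 / 2 * d.toReal, by positivity, by linarith, ?_, ?_, ?_⟩
    · unfold Adm
      rw [← hd, h2]
      exact (ENNReal.ofReal_lt_ofReal_iff (by positivity)).2 (by linarith)
    · ext y
      have := hdist y
      simp only [mem_ball]
      constructor <;> intro _ <;> linarith
    · intro s _ hs
      unfold Adm at hs
      rw [← hd, h2, ENNReal.ofReal_lt_ofReal_iff (by positivity)] at hs
      linarith

lemma rpow_anti {a b : ℝ≥0∞} (h : a ≤ b) {s : ℝ} (hs : 0 ≤ s) : b ^ (-s) ≤ a ^ (-s) := by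
  rw [ENNReal.rpow_neg, ENNReal.rpow_neg]
  exact ENNReal.inv_le_inv.2 (ENNReal.rpow_le_rpow h hs)

/-- Comparable real numbers have comparable powers. -/
lemma rpow_comp {a b M : ℝ} (ha : 0 < a) (hb : 0 < b) (hM : 0 < M) (h1 : a ≤ M * b)
    (h2 : b ≤ M * a) (t : ℝ) :
    ENNReal.ofReal a ^ t ≤ ENNReal.ofReal M ^ |t| * ENNReal.ofReal b ^ t := by
  rw [ENNReal.ofReal_rpow_of_pos ha, ENNReal.ofReal_rpow_of_pos hb, ENNReal.ofReal_rpow_of_pos hM,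
    ← ENNReal.ofReal_mul (by positivity)]
  apply ENNReal.ofReal_le_ofReal
  rcases le_total 0 t with ht | ht
  · rw [abs_of_nonneg ht, ← Real.mul_rpow hM.le hb.le]
    exact Real.rpow_le_rpow ha.le h1 ht
  · rw [abs_of_nonpos ht]
    have : (M * a) ^ t ≤ b ^ t := Real.rpow_le_rpow_of_nonpos hb h2 ht
    rw [Real.mul_rpow hM.le ha.le] at this
    have h3 : M ^ (-t) * M ^ t = 1 := by rw [← Real.rpow_add hM]; simp
    calc a ^ t = M ^ (-t) * (M ^ t * a ^ t) := by rw [← mul_assoc, h3, one_mul]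
      _ ≤ _ := by gcongr

lemma ofReal_rpow_ne {a : ℝ} (ha : 0 < a) (t : ℝ) :
    ENNReal.ofReal a ^ t ≠ 0 ∧ ENNReal.ofReal a ^ t ≠ ∞ := by
  rw [ENNReal.ofReal_rpow_of_pos ha]
  exact ⟨by simpa using Real.rpow_pos_of_pos ha t, ENNReal.ofReal_ne_top⟩

lemma doubling_iter {μ : Measure X} (hdbl : Doubling μ) (K : ℝ) :
    ∃ M : ℝ≥0∞, M ≠ ∞ ∧ ∀ (x : X) (r : ℝ), 0 < r → μ (ball x (K * r)) ≤ M * μ (ball x r) := by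
  obtain ⟨C, hC, h⟩ := hdbl
  have key : ∀ n : ℕ, ∀ (x : X) (r : ℝ), 0 < r →
      μ (ball x (2 ^ n * r)) ≤ ENNReal.ofReal C ^ n * μ (ball x r) := by
    intro n
    induction n with
    | zero => intro x r hr; simp
    | succ n ih =>
      intro x r hr
      calc μ (ball x (2 ^ (n + 1) * r)) = μ (ball x (2 * (2 ^ n * r))) := by ring_nf
        _ ≤ ENNReal.ofReal C * μ (ball x (2 ^ n * r)) := h _ _ (by positivity)
        _ ≤ ENNReal.ofReal C * (ENNReal.ofReal C ^ n * μ (ball x r)) := by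
          gcongr; exact ih x r hr
        _ = _ := by rw [pow_succ]; ring
  obtain ⟨n, hn⟩ := pow_unbounded_of_one_lt K (one_lt_two)
  refine ⟨ENNReal.ofReal C ^ n, by simp, fun x r hr => ?_⟩
  refine (measure_mono (ball_subset_ball ?_)).trans (key n x r hr)
  gcongr

lemma measurable_distWeight (E : Set X) (α : ℝ) : Measurable (distWeight E α) := by
  unfold distWeight
  exact (measurable_infDist.ennreal_ofReal).pow_const _

/-- Holes of porous sets. -/
lemma exists_hole {μ : Measure X} (hdbl : Doubling μ) {E : Set X} (hE : E.Nonempty)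
    (hpor : IsPorous E) :
    ∃ c : ℝ, 0 < c ∧ c < 1 / 2 ∧ ∃ M : ℝ≥0∞, M ≠ ∞ ∧ ∀ x ∈ E, ∀ r : ℝ, 0 < r → Adm X r →
      ∃ H : Set X, MeasurableSet H ∧ H ⊆ ball x r ∧ (∀ y ∈ H, c * r ≤ infDist y E) ∧
        μ (ball x (6 * r)) ≤ M * μ H := by
  obtain ⟨c, hc0, hc1, h⟩ := hpor
  obtain ⟨M, hM, hM2⟩ := doubling_iter hdbl (14 / c)
  refine ⟨c / 2, by positivity, by linarith, M, hM, fun x hx r hr hadm => ?_⟩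
  obtain ⟨y, hy⟩ := h x hx r hr hadm
  have hcr : 0 < c * r := by positivity
  refine ⟨ball y (c / 2 * r), measurableSet_ball, ?_, ?_, ?_⟩
  · refine (ball_subset_ball ?_).trans (hy.trans diff_subset)
    nlinarith
  · intro u hu
    refine (le_infDist hE).2 fun e he => ?_
    by_contra hlt
    rw [not_le] at hlt
    have : e ∈ ball y (c * r) := by
      rw [mem_ball] at hu ⊢
      have := dist_triangle e u y
      rw [dist_comm e u] at this
      linarith
    exact (hy this).2 he
  · have hyx : dist y x < r := (hy (mem_ball_self hcr)).1
    refine le_trans (measure_mono ?_) (hM2 y (c / 2 * r) (by positivity))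
    apply ball_subset_ball'
    have : 14 / c * (c / 2 * r) = 7 * r := by field_simp; norm_num
    rw [this, dist_comm]
    linarith

lemma infDist_lt_of_mem_ball {E : Set X} {x : X} (hx : x ∈ E) {y : X} {r : ℝ}
    (hy : y ∈ ball x r) : infDist y E < r :=
  lt_of_le_of_lt (infDist_le_dist_of_mem hx) hy

def Aik (μ : Measure X) (E : Set X) (α : ℝ) : Prop :=
  ∃ C : ℝ≥0∞, C ≠ ∞ ∧ ∀ x ∈ E, ∀ r : ℝ, 0 < r → Adm X r →
    ∫⁻ y in ball x r, distWeight E α y ∂μ ≤ C * ENNReal.ofReal r ^ (-α) * μ (ball x r)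

lemma aik_of_nonpos (μ : Measure X) (E : Set X) {α : ℝ} (hα : α ≤ 0) : Aik μ E α := by
  refine ⟨1, by simp, fun x hx r hr _ => ?_⟩
  rw [one_mul, ← setLIntegral_const]
  refine setLIntegral_mono' measurableSet_ball fun y hy => ?_
  unfold distWeight
  exact ENNReal.rpow_le_rpow (ENNReal.ofReal_le_ofReal (infDist_lt_of_mem_ball hx hy).le)
    (by linarith)

/-- The decay step. -/
lemma decay_step {μ : Measure X} (hballs : BallsPosFinite μ) (hdbl : Doubling μ) {E : Set X}
    (hE : E.Nonempty) (hpor : IsPorous E) {α : ℝ} (hα : 0 ≤ α) (hA : Aik μ E α) :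
    ∃ c : ℝ, 0 < c ∧ c < 1 / 2 ∧ ∃ K : ℝ≥0∞, K ≠ ∞ ∧ ∀ (x : X) (r ρ : ℝ), 0 < r →
      Adm X (6 * r) →
      (1 + K) * ∫⁻ y in {y | infDist y E < c * r} ∩ ball x ρ, distWeight E α y ∂μ ≤
        K * ∫⁻ y in {y | infDist y E < r} ∩ ball x (ρ + 2 * r), distWeight E α y ∂μ := by
  obtain ⟨c, hc0, hc1, M, hM, hH⟩ := exists_hole hdbl hE hpor
  obtain ⟨C, hC, hA⟩ := hA
  refine ⟨c, hc0, hc1, C * M, ENNReal.mul_ne_top hC hM, fun x r ρ hr hadm => ?_⟩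
  have hmeas : ∀ s : ℝ, MeasurableSet {y | infDist y E < s} := fun s =>
    (isOpen_lt (continuous_infDist_pt E) continuous_const).measurableSet
  set w := distWeight E α with hw
  -- the covering
  obtain ⟨u, hut, hdisj, hcov⟩ := Vitali.exists_disjoint_subfamily_covering_enlargement_closedBall
    (E ∩ ball x (ρ + r)) (fun z : X => z) (fun _ => r) r (fun _ _ => le_rfl) 5 (by norm_num)
  have hucount : u.Countable := by
    have hfin : μ (ball x (|ρ| + 2 * r)) < ∞ := (hballs x _ (by positivity)).2
    have : IsFiniteMeasure (μ.restrict (ball x (|ρ| + 2 * r))) := ⟨by simpa using hfin⟩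
    have hc := Measure.countable_meas_pos_of_disjoint_iUnion
      (μ := μ.restrict (ball x (|ρ| + 2 * r))) (As := fun b : u => ball (b : X) r)
      (fun b => measurableSet_ball) (by
        intro a b hab
        have := hdisj a.2 b.2 (fun h => hab (Subtype.ext h))
        exact this.mono ball_subset_closedBall ball_subset_closedBall)
    have huniv : {i : u | 0 < μ.restrict (ball x (|ρ| + 2 * r)) (ball (i : X) r)} = univ := by
      ext i
      simp only [mem_setOf_eq, mem_univ, iff_true]
      rw [Measure.restrict_apply measurableSet_ball, inter_eq_self_of_subset_left]
      · exact (hballs _ _ hr).1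
      · apply ball_subset_ball'
        have := (hut i.2).2
        rw [mem_ball] at this
        have := le_abs_self ρ
        linarith
    rw [huniv] at hc
    exact countable_coe_iff.1 (countable_univ_iff.1 hc)
  have hadm' : Adm X r := hadm.mono (by linarith)
  choose! H hHm hHs hHd hHμ using fun z (hz : z ∈ E) => hH z hz r hr hadm'
  have huE : ∀ b ∈ u, b ∈ E := fun b hb => (hut hb).1
  -- annulus
  set Ann := {y | c * r ≤ infDist y E ∧ infDist y E < r} ∩ ball x (ρ + 2 * r) with hAnn
  have hT : ∫⁻ y in {y | infDist y E < r} ∩ ball x ρ, w y ∂μ ≤ C * M * ∫⁻ y in Ann, w y ∂μ := by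
    have hsub : {y | infDist y E < r} ∩ ball x ρ ⊆ ⋃ b ∈ u, ball b (6 * r) := by
      rintro y ⟨hy1, hy2⟩
      obtain ⟨z, hz, hyz⟩ := (infDist_lt_iff hE).1 hy1
      have hzt : z ∈ E ∩ ball x (ρ + r) := by
        refine ⟨hz, ?_⟩
        rw [mem_ball] at hy2 ⊢
        have := dist_triangle z y x
        rw [dist_comm z y] at this
        linarith
      obtain ⟨b, hb, hsub⟩ := hcov z hzt
      have : y ∈ closedBall b (5 * r) := hsub (by simpa using hyz.le)
      rw [mem_closedBall] at this
      simp only [mem_iUnion, mem_ball]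
      exact ⟨b, hb, by linarith⟩
    calc ∫⁻ y in {y | infDist y E < r} ∩ ball x ρ, w y ∂μ
        ≤ ∫⁻ y in ⋃ b ∈ u, ball b (6 * r), w y ∂μ := lintegral_mono_set hsub
      _ ≤ ∑' b : u, ∫⁻ y in ball (b : X) (6 * r), w y ∂μ := by
          have := hucount.to_subtype
          rw [biUnion_eq_iUnion]
          exact lintegral_iUnion_le _ _
      _ ≤ ∑' b : u, C * M * ∫⁻ y in H b, w y ∂μ := by
          refine ENNReal.tsum_le_tsum fun b => ?_
          calc ∫⁻ y in ball (b : X) (6 * r), w y ∂μ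
              ≤ C * ENNReal.ofReal (6 * r) ^ (-α) * μ (ball (b : X) (6 * r)) :=
                hA b (huE b b.2) _ (by positivity) hadm
            _ ≤ C * ENNReal.ofReal r ^ (-α) * (M * μ (H b)) := by
                refine mul_le_mul' (mul_le_mul' le_rfl ?_) (hHμ b (huE b b.2))
                exact rpow_anti (ENNReal.ofReal_le_ofReal (by linarith)) hα
            _ = C * M * (ENNReal.ofReal r ^ (-α) * μ (H b)) := by ring
            _ ≤ _ := by
                gcongr
                rw [← setLIntegral_const]
                refine setLIntegral_mono' (hHm b (huE b b.2)) fun y hy => ?_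
                exact rpow_anti (ENNReal.ofReal_le_ofReal
                  (infDist_lt_of_mem_ball (huE b b.2) (hHs b (huE b b.2) hy)).le) hα
      _ = C * M * ∫⁻ y in ⋃ b : u, H b, w y ∂μ := by
          have := hucount.to_subtype
          rw [ENNReal.tsum_mul_left, lintegral_iUnion (fun b : u => hHm b (huE b b.2))]
          intro a b hab
          have := hdisj a.2 b.2 (fun h => hab (Subtype.ext h))
          exact this.mono ((hHs a (huE a a.2)).trans ball_subset_closedBall)
            ((hHs b (huE b b.2)).trans ball_subset_closedBall)
      _ ≤ C * M * ∫⁻ y in Ann, w y ∂μ := by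
          gcongr
          refine iUnion_subset fun b y hy => ⟨⟨hHd b (huE b b.2) y hy, ?_⟩, ?_⟩
          · exact infDist_lt_of_mem_ball (huE b b.2) (hHs b (huE b b.2) hy)
          · have h1 := hHs b (huE b b.2) hy
            have h2 := (hut b.2).2
            rw [mem_ball] at h1 h2 ⊢
            have := dist_triangle y b x
            linarith
  have hcr : c * r ≤ r := by nlinarith
  calc (1 + C * M) * ∫⁻ y in {y | infDist y E < c * r} ∩ ball x ρ, w y ∂μ
      = (∫⁻ y in {y | infDist y E < c * r} ∩ ball x ρ, w y ∂μ) +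
        C * M * ∫⁻ y in {y | infDist y E < c * r} ∩ ball x ρ, w y ∂μ := by ring
    _ ≤ C * M * (∫⁻ y in Ann, w y ∂μ) +
        C * M * ∫⁻ y in {y | infDist y E < c * r} ∩ ball x (ρ + 2 * r), w y ∂μ := by
        gcongr ?_ + _ * ?_
        · refine le_trans (lintegral_mono_set ?_) hT
          exact fun y hy => ⟨lt_of_lt_of_le hy.1 hcr, hy.2⟩
        · refine lintegral_mono_set ?_
          exact fun y hy => ⟨hy.1, ball_subset_ball (by linarith) hy.2⟩
    _ = C * M * ∫⁻ y in Ann ∪ ({y | infDist y E < c * r} ∩ ball x (ρ + 2 * r)), w y ∂μ := by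
        rw [lintegral_union ((hmeas _).inter measurableSet_ball), mul_add]
        rw [Set.disjoint_left]
        rintro y ⟨hy, -⟩ ⟨hy', -⟩
        exact absurd hy.1 (not_le.2 hy')
    _ ≤ _ := by
        gcongr
        rintro y (hy | hy)
        · exact ⟨hy.1.2, hy.2⟩
        · exact ⟨lt_of_lt_of_le hy.1 hcr, hy.2⟩

/-- Iterated decay. -/
lemma decay_iter {μ : Measure X} (hballs : BallsPosFinite μ) (hdbl : Doubling μ) {E : Set X}
    (hE : E.Nonempty) (hpor : IsPorous E) {α : ℝ} (hα : 0 ≤ α) (hA : Aik μ E α) :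
    ∃ c : ℝ, 0 < c ∧ c < 1 / 2 ∧ ∃ θ : ℝ, 0 < θ ∧ θ < 1 ∧ ∀ (x : X) (r : ℝ), 0 < r →
      Adm X (6 * r) → ∀ (k : ℕ) (ρ : ℝ),
      ∫⁻ y in {y | infDist y E < c ^ k * r} ∩ ball x ρ, distWeight E α y ∂μ ≤
        ENNReal.ofReal (θ ^ k) *
        ∫⁻ y in {y | infDist y E < r} ∩ ball x (ρ + 4 * r - 4 * r * c ^ k),
          distWeight E α y ∂μ := by
  obtain ⟨c, hc0, hc1, K, hK, h⟩ := decay_step hballs hdbl hE hpor hα hA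
  have hk0 : 0 ≤ K.toReal := ENNReal.toReal_nonneg
  set k0 := K.toReal with hk0d
  have hKe : K = ENNReal.ofReal k0 := (ENNReal.ofReal_toReal hK).symm
  refine ⟨c, hc0, hc1, (k0 + 1) / (k0 + 2), by positivity, ?_, ?_⟩
  · rw [div_lt_one (by positivity)]; linarith
  have step : ∀ (x : X) (r ρ : ℝ), 0 < r → Adm X (6 * r) →
      ∫⁻ y in {y | infDist y E < c * r} ∩ ball x ρ, distWeight E α y ∂μ ≤
      ENNReal.ofReal ((k0 + 1) / (k0 + 2)) *
        ∫⁻ y in {y | infDist y E < r} ∩ ball x (ρ + 2 * r), distWeight E α y ∂μ := by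
    intro x r ρ hr hadm
    have h1 := h x r ρ hr hadm
    have h1K : 1 + K = ENNReal.ofReal (1 + k0) := by
      rw [ENNReal.ofReal_add zero_le_one hk0, ← hKe]; simp
    rw [h1K, hKe] at h1
    set T1 := ∫⁻ y in {y | infDist y E < c * r} ∩ ball x ρ, distWeight E α y ∂μ
    set T2 := ∫⁻ y in {y | infDist y E < r} ∩ ball x (ρ + 2 * r), distWeight E α y ∂μ
    calc T1 = ENNReal.ofReal ((1 + k0)⁻¹) * (ENNReal.ofReal (1 + k0) * T1) := by
          rw [← mul_assoc, ← ENNReal.ofReal_mul (by positivity), inv_mul_cancel₀ (by positivity)]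
          simp
      _ ≤ ENNReal.ofReal ((1 + k0)⁻¹) * (ENNReal.ofReal k0 * T2) := by gcongr
      _ = ENNReal.ofReal ((1 + k0)⁻¹ * k0) * T2 := by
          rw [← mul_assoc, ← ENNReal.ofReal_mul (by positivity)]
      _ ≤ _ := by
          gcongr
          rw [inv_mul_eq_div, div_le_div_iff₀ (by positivity) (by positivity)]
          nlinarith
  intro x r hr hadm k
  induction k with
  | zero => intro ρ; simp
  | succ k ih =>
    intro ρ
    have hck : 0 < c ^ k := by positivity
    have hck1 : c ^ k ≤ 1 := pow_le_one₀ hc0.le (by linarith)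
    have h1 := step x (c ^ k * r) ρ (by positivity) (hadm.mono (by nlinarith))
    have h2 := ih (ρ + 2 * (c ^ k * r))
    rw [show c ^ (k + 1) * r = c * (c ^ k * r) by ring]
    refine h1.trans ?_
    refine (mul_le_mul' le_rfl h2).trans ?_
    rw [← mul_assoc, ← ENNReal.ofReal_mul (by positivity), ← pow_succ']
    gcongr ENNReal.ofReal _ * ?_
    refine lintegral_mono_set fun y hy => ⟨hy.1, ball_subset_ball ?_ hy.2⟩
    have : c ^ (k + 1) ≤ 1 / 2 * c ^ k := by rw [pow_succ']; gcongr
    nlinarith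

lemma self_improve [Nontrivial X] {μ : Measure X} (hballs : BallsPosFinite μ) (hdbl : Doubling μ)
    {E : Set X} (hE : E.Nonempty) (hpor : IsPorous E) {α : ℝ} (hα : 0 ≤ α) (hA : Aik μ E α) :
    ∃ ρ ∈ assouadCodimBddSet μ E, α < ρ := by
  obtain ⟨c, hc0, hc1, θ, hθ0, hθ1, hdec⟩ := decay_iter hballs hdbl hE hpor hα hA
  obtain ⟨C, hC, hA⟩ := hA
  obtain ⟨M, hM, hM2⟩ := doubling_iter hdbl 2
  set ε := Real.log θ / Real.log c with hε
  have hlogc : Real.log c < 0 := Real.log_neg hc0 (by linarith)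
  have hεpos : 0 < ε := div_pos_of_neg_of_neg (Real.log_neg hθ0 hθ1) hlogc
  have hcε : c ^ ε = θ := by
    rw [Real.rpow_def_of_pos hc0, hε, mul_div_cancel₀ _ hlogc.ne, Real.exp_log hθ0]
  set D := (C * M).toReal with hD
  have hDe : C * M = ENNReal.ofReal D := (ENNReal.ofReal_toReal (ENNReal.mul_ne_top hC hM)).symm
  have hD0 : 0 ≤ D := ENNReal.toReal_nonneg
  refine ⟨α + ε, ⟨by positivity, 1 + 8 ^ (α + ε) + D * 2 ^ α * θ⁻¹ * 8 ^ ε, ?_, ?_⟩, by linarith⟩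
  · have h1 : (0:ℝ) ≤ 8 ^ (α + ε) := by positivity
    have h2 : 0 ≤ D * 2 ^ α * θ⁻¹ * 8 ^ ε := by positivity
    linarith
  intro x hx r R hr hrR hadm
  have hR : 0 < R := hr.trans hrR
  change Adm X R at hadm
  have h1 : (0:ℝ) < 8 ^ (α + ε) := by positivity
  have h2 : 0 ≤ D * 2 ^ α * θ⁻¹ * 8 ^ ε := by positivity
  rcases lt_or_ge (R / 8) r with hlt | hle
  · calc μ ({y | infDist y E < r} ∩ ball x R) ≤ μ (ball x R) := measure_mono inter_subset_right
      _ = ENNReal.ofReal 1 * μ (ball x R) := by simp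
      _ ≤ _ := by
        gcongr
        calc (1:ℝ) ≤ (8 * (r / R)) ^ (α + ε) := by
              apply Real.one_le_rpow _ (by positivity)
              rw [← mul_div_assoc, le_div_iff₀ hR]; linarith
          _ = 8 ^ (α + ε) * (r / R) ^ (α + ε) := Real.mul_rpow (by norm_num) (by positivity)
          _ ≤ _ := by
            gcongr
            linarith
  · set w := distWeight E α with hw
    have hr0 : 0 < R / 8 := by positivity
    obtain ⟨k, hk1, hk2⟩ := exists_nat_pow_near_of_lt_one (x := r / (R / 8)) (y := c) (by positivity)
      (by rw [div_le_one hr0]; exact hle) hc0 (by linarith)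
    rw [lt_div_iff₀ hr0] at hk1
    rw [div_le_iff₀ hr0] at hk2
    have s1 : μ ({y | infDist y E < r} ∩ ball x R) ≤
        ENNReal.ofReal (r ^ α) * ∫⁻ y in {y | infDist y E < r} ∩ ball x R, w y ∂μ := by
      have hm : MeasurableSet ({y | infDist y E < r} ∩ ball x R) :=
        ((isOpen_lt (continuous_infDist_pt E) continuous_const).measurableSet).inter
          measurableSet_ball
      have : ENNReal.ofReal r ^ (-α) * μ ({y | infDist y E < r} ∩ ball x R) ≤
          ∫⁻ y in {y | infDist y E < r} ∩ ball x R, w y ∂μ := by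
        rw [← setLIntegral_const]
        refine setLIntegral_mono' hm fun y hy => ?_
        exact rpow_anti (ENNReal.ofReal_le_ofReal (le_of_lt hy.1)) hα
      rw [ENNReal.ofReal_rpow_of_pos hr] at this
      refine le_trans ?_ (mul_le_mul' le_rfl this)
      rw [← mul_assoc, ← ENNReal.ofReal_mul (by positivity), ← Real.rpow_add hr]
      simp
    obtain ⟨t, ht0, ht1, ht2, ht3, ht4⟩ := exists_adm x (3 / 2 * R) (by positivity)
    have htR : R / 2 ≤ t := ht4 R (by linarith) hadm
    have s2 : ∫⁻ y in {y | infDist y E < r} ∩ ball x R, w y ∂μ ≤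
        ENNReal.ofReal (θ ^ k) * (ENNReal.ofReal (D * (R / 2) ^ (-α)) * μ (ball x R)) := by
      calc ∫⁻ y in {y | infDist y E < r} ∩ ball x R, w y ∂μ
          ≤ ∫⁻ y in {y | infDist y E < c ^ k * (R / 8)} ∩ ball x R, w y ∂μ :=
            lintegral_mono_set fun y hy => ⟨lt_of_lt_of_le hy.1 hk2, hy.2⟩
        _ ≤ _ := hdec x (R / 8) hr0 (hadm.mono (by linarith)) k R
        _ ≤ ENNReal.ofReal (θ ^ k) * ∫⁻ y in ball x t, w y ∂μ := by
            gcongr ENNReal.ofReal _ * ?_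
            refine lintegral_mono_set fun y hy => ?_
            rw [ht3]
            refine ball_subset_ball ?_ hy.2
            have : 0 ≤ R * c ^ k := by positivity
            linarith
        _ ≤ _ := by
            gcongr ENNReal.ofReal _ * ?_
            refine (hA x hx t ht0 ht2).trans ?_
            calc C * ENNReal.ofReal t ^ (-α) * μ (ball x t)
                ≤ C * ENNReal.ofReal (R / 2) ^ (-α) * (M * μ (ball x R)) := by
                  refine mul_le_mul' (mul_le_mul' le_rfl ?_) ?_
                  · exact rpow_anti (ENNReal.ofReal_le_ofReal htR) hα
                  · rw [ht3]
                    exact (measure_mono (ball_subset_ball (by linarith))).trans (hM2 x R hR)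
              _ = (C * M) * ENNReal.ofReal (R / 2) ^ (-α) * μ (ball x R) := by ring
              _ = _ := by
                  rw [hDe, ENNReal.ofReal_rpow_of_pos (by positivity), ← ENNReal.ofReal_mul hD0]
    refine s1.trans ((mul_le_mul' le_rfl s2).trans ?_)
    rw [← mul_assoc, ← mul_assoc, ← ENNReal.ofReal_mul (by positivity),
      ← ENNReal.ofReal_mul (by positivity)]
    refine mul_le_mul' (ENNReal.ofReal_le_ofReal ?_) le_rfl
    have e1 : θ ^ k ≤ θ⁻¹ * 8 ^ ε * (r / R) ^ ε := by
      have : θ ^ (k + 1) ≤ (8 * (r / R)) ^ ε := by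
        rw [← hcε, ← Real.rpow_natCast, ← Real.rpow_mul hc0.le, mul_comm, Real.rpow_mul hc0.le,
          Real.rpow_natCast]
        gcongr
        rw [← mul_div_assoc, le_div_iff₀ hR]
        linarith
      rw [Real.mul_rpow (by norm_num) (by positivity)] at this
      calc θ ^ k = θ⁻¹ * θ ^ (k + 1) := by rw [pow_succ]; field_simp
        _ ≤ θ⁻¹ * (8 ^ ε * (r / R) ^ ε) := by gcongr
        _ = _ := by ring
    have e2 : r ^ α * (R / 2) ^ (-α) = 2 ^ α * (r / R) ^ α := by
      rw [Real.rpow_neg (by positivity), Real.div_rpow hR.le (by norm_num),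
        Real.div_rpow hr.le hR.le, inv_div]
      ring
    calc r ^ α * θ ^ k * (D * (R / 2) ^ (-α)) = (D * (r ^ α * (R / 2) ^ (-α))) * θ ^ k := by ring
      _ = (D * (2 ^ α * (r / R) ^ α)) * θ ^ k := by rw [e2]
      _ ≤ (D * (2 ^ α * (r / R) ^ α)) * (θ⁻¹ * 8 ^ ε * (r / R) ^ ε) := by gcongr
      _ = (D * 2 ^ α * θ⁻¹ * 8 ^ ε) * (r / R) ^ (α + ε) := by
          rw [Real.rpow_add (by positivity)]; ring
      _ ≤ _ := by
          gcongr
          linarith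

lemma measurableSet_nbhd (E : Set X) (s : ℝ) : MeasurableSet {y | infDist y E < s} :=
  (isOpen_lt (continuous_infDist_pt E) continuous_const).measurableSet

lemma zero_mem_bddSet (μ : Measure X) (E : Set X) : (0 : ℝ) ∈ assouadCodimBddSet μ E := by
  refine ⟨le_rfl, 1, le_rfl, fun x hx r R _ _ _ => ?_⟩
  simpa using measure_mono inter_subset_right

lemma bddAbove_bddSet [Nontrivial X] {μ : Measure X} (hballs : BallsPosFinite μ)
    (hdbl : Doubling μ) {E : Set X} (hE : E.Nonempty) : BddAbove (assouadCodimBddSet μ E) := by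
  obtain ⟨K, hK, h⟩ := hdbl
  obtain ⟨x, hx⟩ := hE
  obtain ⟨R, hR, -, hadm, -, -⟩ := exists_adm x 1 one_pos
  refine ⟨Real.logb 2 K, ?_⟩
  rintro ρ ⟨hρ, C, hC, hb⟩
  by_contra hlt
  rw [not_le] at hlt
  have hK2 : K < 2 ^ ρ := (Real.logb_lt_iff_lt_rpow (by norm_num) hK).1 hlt
  have key : ∀ n : ℕ, μ (ball x R) ≤ ENNReal.ofReal (K ^ n) * μ (ball x (R / 2 ^ n)) := by
    intro n
    induction n with
    | zero => simp
    | succ n ih =>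
      refine ih.trans ?_
      rw [pow_succ, ENNReal.ofReal_mul (by positivity), mul_assoc]
      gcongr
      have := h x (R / 2 ^ (n + 1)) (by positivity)
      rwa [show 2 * (R / 2 ^ (n + 1)) = R / 2 ^ n by rw [pow_succ]; field_simp] at this
  have h2ρ : (0:ℝ) < 2 ^ ρ := by positivity
  obtain ⟨n, hn⟩ := exists_pow_lt_of_lt_one (x := 1 / (C + 1)) (y := K / 2 ^ ρ) (by positivity)
    (by rw [div_lt_one h2ρ]; exact hK2)
  have hn0 : n ≠ 0 := by
    rintro rfl
    rw [pow_zero, lt_div_iff₀ (by positivity)] at hn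
    linarith
  have hlt1 : R / 2 ^ n < R := div_lt_self hR (one_lt_pow₀ (by norm_num) hn0)
  have h1 := hb x hx (R / 2 ^ n) R (by positivity) hlt1 hadm
  have h2 : μ (ball x (R / 2 ^ n)) ≤ μ ({y : X | infDist y E < R / 2 ^ n} ∩ ball x R) :=
    measure_mono fun y hy => ⟨infDist_lt_of_mem_ball hx hy, ball_subset_ball hlt1.le hy⟩
  have h3 : μ (ball x R) ≤
      ENNReal.ofReal (K ^ n * (C * (R / 2 ^ n / R) ^ ρ)) * μ (ball x R) := by
    rw [ENNReal.ofReal_mul (by positivity), mul_assoc]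
    exact (key n).trans (mul_le_mul' le_rfl (h2.trans h1))
  have h4 : K ^ n * (C * (R / 2 ^ n / R) ^ ρ) < 1 := by
    have e : R / 2 ^ n / R = (2 ^ n)⁻¹ := by field_simp
    have e2 : ((2:ℝ) ^ n) ^ ρ = (2 ^ ρ) ^ n := by
      rw [← Real.rpow_natCast, ← Real.rpow_natCast, ← Real.rpow_mul (by norm_num),
        ← Real.rpow_mul (by norm_num), mul_comm]
    rw [e, Real.inv_rpow (by positivity), e2]
    rw [div_pow, lt_div_iff₀ (by positivity)] at hn
    have : K ^ n * (C * ((2 ^ ρ) ^ n)⁻¹) = C * (K ^ n / (2 ^ ρ) ^ n) := by ring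
    rw [this]
    have hq : 0 < K ^ n / (2 ^ ρ) ^ n := by positivity
    nlinarith
  obtain ⟨p1, p2⟩ := hballs x R hR
  refine absurd h3 (not_le.2 ?_)
  calc _ < 1 * μ (ball x R) := by
        rw [ENNReal.mul_lt_mul_iff_left p1.ne' p2.ne]
        simpa using h4
    _ = _ := one_mul _

lemma null_of_mem [Nontrivial X] {μ : Measure X} (hballs : BallsPosFinite μ)
    {E : Set X} (hE : E.Nonempty) {ρ : ℝ} (hρ : 0 < ρ)
    (hm : ρ ∈ assouadCodimBddSet μ E) : μ E = 0 := by
  obtain ⟨-, C, hC, hb⟩ := hm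
  obtain ⟨x, hx⟩ := hE
  have key : ∀ R : ℝ, 0 < R → μ (E ∩ ball x R) = 0 := by
    intro R hR
    obtain ⟨t, ht, -, hadm, hbt, -⟩ := exists_adm x R hR
    rw [← hbt]
    have hlim : Filter.Tendsto (fun n : ℕ => ENNReal.ofReal (C * (((1/2 : ℝ) ^ ρ) ^ n)) * μ (ball x t))
        Filter.atTop (nhds 0) := by
      have h0 : Filter.Tendsto (fun n : ℕ => C * (((1/2 : ℝ) ^ ρ) ^ n)) Filter.atTop (nhds (C * 0)) :=
        (tendsto_pow_atTop_nhds_zero_of_lt_one (by positivity)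
          (Real.rpow_lt_one (by norm_num) (by norm_num) hρ)).const_mul C
      have h1 := (ENNReal.continuous_ofReal.tendsto _).comp h0
      have h2 := ENNReal.Tendsto.mul_const (b := μ (ball x t)) h1 (Or.inr (hballs x t ht).2.ne)
      simpa using h2
    refine le_antisymm (ge_of_tendsto hlim ?_) bot_le
    filter_upwards [Filter.eventually_ge_atTop 1] with n hn
    have h1 := hb x hx ((1/2)^n * t) t (by positivity) (by
      have : (1/2 : ℝ)^n < 1 := pow_lt_one₀ (by norm_num) (by norm_num) (by omega)
      nlinarith) hadm
    refine (measure_mono ?_).trans (h1.trans (le_of_eq ?_))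
    · rintro y ⟨hy, hy'⟩
      refine ⟨?_, hy'⟩
      rw [mem_setOf_eq, infDist_zero_of_mem hy]
      positivity
    · rw [mul_div_assoc, div_self ht.ne', mul_one, ← Real.rpow_natCast, ← Real.rpow_natCast,
        ← Real.rpow_mul (by norm_num), ← Real.rpow_mul (by norm_num), mul_comm ρ]
  have hcov : E ⊆ ⋃ n : ℕ, E ∩ ball x (n + 1) := by
    intro y hy
    obtain ⟨n, hn⟩ := exists_nat_gt (dist y x)
    refine mem_iUnion.2 ⟨n, hy, ?_⟩
    rw [mem_ball]; linarith
  exact measure_mono_null hcov (measure_iUnion_null fun n => key _ (by positivity))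

lemma aik_of_mem [Nontrivial X] {μ : Measure X} (hballs : BallsPosFinite μ)
    {E : Set X} (hE : E.Nonempty) (hEc : IsClosed E) {α ρ : ℝ} (hα : 0 ≤ α) (hαρ : α < ρ)
    (hm : ρ ∈ assouadCodimBddSet μ E) : Aik μ E α := by
  have hnull := null_of_mem hballs hE (lt_of_le_of_lt hα hαρ) hm
  obtain ⟨-, C, hC, hb⟩ := hm
  set q : ℝ := (1 / 2) ^ (ρ - α) with hq
  have hq0 : 0 < q := by positivity
  have hq1 : q < 1 := Real.rpow_lt_one (by norm_num) (by norm_num) (by linarith)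
  refine ⟨ENNReal.ofReal (C * 2 ^ ρ * 2 ^ α) * ∑' k : ℕ, ENNReal.ofReal q ^ k, ?_, ?_⟩
  · refine ENNReal.mul_ne_top ENNReal.ofReal_ne_top ?_
    rw [ENNReal.tsum_geometric]
    rw [Ne, ENNReal.inv_eq_top, tsub_eq_zero_iff_le, not_le]
    simpa using hq1
  intro x hx r hr hadm
  set L : ℕ → Set X := fun k =>
    {y | (1/2 : ℝ) ^ (k + 1) * r ≤ infDist y E ∧ infDist y E ≤ (1/2) ^ k * r} ∩ ball x r with hL
  have hLm : ∀ k, MeasurableSet (L k) := fun k =>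
    ((measurableSet_le measurable_const measurable_infDist).inter
      (measurableSet_le measurable_infDist measurable_const)).inter measurableSet_ball
  have hcov : ball x r ⊆ E ∪ ⋃ k, L k := by
    intro y hy
    by_cases hyE : y ∈ E
    · exact Or.inl hyE
    right
    have hpos : 0 < infDist y E := (hEc.notMem_iff_infDist_pos hE).1 hyE
    obtain ⟨k, hk1, hk2⟩ := exists_nat_pow_near_of_lt_one (x := infDist y E / r) (y := (1/2 : ℝ))
      (by positivity) (by rw [div_le_one hr]; exact (infDist_lt_of_mem_ball hx hy).le)
      (by norm_num) (by norm_num)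
    rw [lt_div_iff₀ hr] at hk1
    rw [div_le_iff₀ hr] at hk2
    exact mem_iUnion.2 ⟨k, ⟨hk1.le, hk2⟩, hy⟩
  have hμL : ∀ k, μ (L k) ≤ ENNReal.ofReal (C * 2 ^ ρ * ((1/2) ^ k) ^ ρ) * μ (ball x r) := by
    intro k
    rcases Nat.eq_zero_or_pos k with rfl | hk
    · refine (measure_mono inter_subset_right).trans ?_
      calc μ (ball x r) = ENNReal.ofReal 1 * μ (ball x r) := by simp
        _ ≤ _ := by
          refine mul_le_mul' (ENNReal.ofReal_le_ofReal ?_) le_rfl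
          have : (1:ℝ) ≤ 2 ^ ρ := Real.one_le_rpow (by norm_num) (by linarith)
          simp only [pow_zero, Real.one_rpow, mul_one]
          nlinarith
    · rcases Nat.eq_zero_or_pos (k - 1) with hk1 | hk1
      · have : k = 1 := by omega
        subst this
        refine (measure_mono inter_subset_right).trans ?_
        calc μ (ball x r) = ENNReal.ofReal 1 * μ (ball x r) := by simp
          _ ≤ _ := by
            refine mul_le_mul' (ENNReal.ofReal_le_ofReal ?_) le_rfl
            rw [mul_assoc, pow_one, ← Real.mul_rpow (by norm_num) (by norm_num)]
            norm_num
            exact hC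
      · obtain ⟨j, rfl⟩ : ∃ j, k = j + 1 := ⟨k - 1, by omega⟩
        have hj : j ≠ 0 := by omega
        have h1 := hb x hx ((1/2)^j * r) r (by positivity) (by
          have : (1/2 : ℝ)^j < 1 := pow_lt_one₀ (by norm_num) (by norm_num) hj
          nlinarith) hadm
        refine (measure_mono ?_).trans (h1.trans (le_of_eq ?_))
        · rintro y ⟨⟨-, hy⟩, hy'⟩
          refine ⟨lt_of_le_of_lt hy ?_, hy'⟩
          have : (0:ℝ) < (1/2)^j := by positivity
          rw [pow_succ]; nlinarith
        · rw [mul_div_assoc, div_self hr.ne', mul_one, mul_assoc,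
            ← Real.mul_rpow (by norm_num) (by positivity), pow_succ]
          congr 4
          ring
  have hint : ∀ k, ∫⁻ y in L k, distWeight E α y ∂μ ≤
      ENNReal.ofReal (C * 2 ^ ρ * 2 ^ α) * ENNReal.ofReal r ^ (-α) * μ (ball x r) *
        ENNReal.ofReal q ^ k := by
    intro k
    have hs : (0:ℝ) < (1/2 : ℝ) ^ (k + 1) * r := by positivity
    calc ∫⁻ y in L k, distWeight E α y ∂μ
        ≤ ∫⁻ y in L k, ENNReal.ofReal ((1/2 : ℝ) ^ (k + 1) * r) ^ (-α) ∂μ := by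
          refine setLIntegral_mono' (hLm k) fun y hy => ?_
          exact rpow_anti (ENNReal.ofReal_le_ofReal hy.1.1) hα
      _ = ENNReal.ofReal (((1/2 : ℝ) ^ (k + 1) * r) ^ (-α)) * μ (L k) := by
          rw [setLIntegral_const, ENNReal.ofReal_rpow_of_pos hs]
      _ ≤ ENNReal.ofReal (((1/2 : ℝ) ^ (k + 1) * r) ^ (-α)) *
          (ENNReal.ofReal (C * 2 ^ ρ * ((1/2) ^ k) ^ ρ) * μ (ball x r)) :=
          mul_le_mul' le_rfl (hμL k)
      _ = ENNReal.ofReal ((C * 2 ^ ρ * 2 ^ α) * r ^ (-α) * q ^ k) * μ (ball x r) := by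
          rw [← mul_assoc, ← ENNReal.ofReal_mul (by positivity)]
          congr 2
          have e1 : ((1/2 : ℝ) ^ (k + 1) * r) ^ (-α) =
              2 ^ α * ((1/2 : ℝ) ^ k) ^ (-α) * r ^ (-α) := by
            rw [Real.mul_rpow (by positivity) hr.le, pow_succ,
              Real.mul_rpow (by positivity) (by norm_num)]
            have : ((1:ℝ)/2) ^ (-α) = 2 ^ α := by
              rw [one_div, Real.inv_rpow (by norm_num), Real.rpow_neg (by norm_num), inv_inv]
            rw [this]; ring
          have e2 : ((1/2 : ℝ) ^ k) ^ (-α) * ((1/2 : ℝ) ^ k) ^ ρ = q ^ k := by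
            rw [← Real.rpow_add (by positivity), hq, ← Real.rpow_natCast, ← Real.rpow_natCast,
              ← Real.rpow_mul (by norm_num), ← Real.rpow_mul (by norm_num)]
            congr 1; ring
          rw [e1, ← e2]; ring
      _ = _ := by
          rw [ENNReal.ofReal_mul (by positivity), ENNReal.ofReal_mul (by positivity),
            ENNReal.ofReal_rpow_of_pos hr, ENNReal.ofReal_pow hq0.le]
          ring
  calc ∫⁻ y in ball x r, distWeight E α y ∂μ
      ≤ ∫⁻ y in E ∪ ⋃ k, L k, distWeight E α y ∂μ := lintegral_mono_set hcov
    _ ≤ (∫⁻ y in E, distWeight E α y ∂μ) + ∫⁻ y in ⋃ k, L k, distWeight E α y ∂μ :=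
        lintegral_union_le _ _ _
    _ = ∫⁻ y in ⋃ k, L k, distWeight E α y ∂μ := by
        rw [setLIntegral_measure_zero _ _ hnull, zero_add]
    _ ≤ ∑' k, ∫⁻ y in L k, distWeight E α y ∂μ := lintegral_iUnion_le _ _
    _ ≤ ∑' k, ENNReal.ofReal (C * 2 ^ ρ * 2 ^ α) * ENNReal.ofReal r ^ (-α) * μ (ball x r) *
        ENNReal.ofReal q ^ k := ENNReal.tsum_le_tsum hint
    _ = _ := by rw [ENNReal.tsum_mul_left]; ring

lemma avg_upper [Nontrivial X] (μ : Measure X) (hballs : BallsPosFinite μ) (hdbl : Doubling μ)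
    {E : Set X} (hE : E.Nonempty) :
    ∃ t : X → ℝ → ℝ, (∀ x r, 0 < r → 0 < t x r) ∧ ∀ γ : ℝ, Aik μ E γ →
      ∃ K : ℝ≥0∞, K ≠ ∞ ∧ ∀ x r, 0 < r →
        (∫⁻ y in ball x r, distWeight E γ y ∂μ) / μ (ball x r) ≤
          K * ENNReal.ofReal (t x r) ^ (-γ) := by
  have hex : ∀ (x : X) (r : ℝ), 0 < r → ∃ t : ℝ, 0 < t ∧
      ((2 * r ≤ infDist x E ∧ t = infDist x E) ∨
        (∃ z ∈ E, dist x z < 2 * r ∧ Adm X t ∧ ball z t = ball z (3 * r))) := by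
    intro x r hr
    rcases le_or_gt (2 * r) (infDist x E) with h | h
    · exact ⟨infDist x E, by linarith, Or.inl ⟨h, rfl⟩⟩
    · obtain ⟨z, hz, hxz⟩ := (infDist_lt_iff hE).1 h
      obtain ⟨t, ht, -, hadm, hb, -⟩ := exists_adm z (3 * r) (by positivity)
      exact ⟨t, ht, Or.inr ⟨z, hz, hxz, hadm, hb⟩⟩
  choose! t ht0 ht using hex
  refine ⟨t, ht0, fun γ hγ => ?_⟩
  obtain ⟨C, hC, hA⟩ := hγ
  obtain ⟨M, hM, hM2⟩ := doubling_iter hdbl 5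
  refine ⟨C * M + ENNReal.ofReal 2 ^ |-γ|, ?_, fun x r hr => ?_⟩
  · exact ENNReal.add_ne_top.2 ⟨ENNReal.mul_ne_top hC hM, (ofReal_rpow_ne two_pos _).2⟩
  obtain ⟨p1, p2⟩ := hballs x r hr
  apply ENNReal.div_le_of_le_mul
  rcases ht x r hr with ⟨h1, h2⟩ | ⟨z, hz, hxz, hadm, hb⟩
  · rw [h2]
    have hd : 0 < infDist x E := by linarith
    refine le_trans ?_ (mul_le_mul' (mul_le_mul' le_add_self le_rfl) le_rfl)
    rw [← setLIntegral_const]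
    refine setLIntegral_mono' measurableSet_ball fun y hy => ?_
    rw [mem_ball] at hy
    have e1 : infDist y E ≤ infDist x E + dist y x := infDist_le_infDist_add_dist
    have e2 : infDist x E ≤ infDist y E + dist x y := infDist_le_infDist_add_dist
    rw [dist_comm x y] at e2
    exact rpow_comp (by linarith) hd two_pos (by linarith) (by linarith) _
  · refine le_trans ?_ (mul_le_mul' (mul_le_mul' le_self_add le_rfl) le_rfl)
    calc ∫⁻ y in ball x r, distWeight E γ y ∂μ ≤ ∫⁻ y in ball z (t x r), distWeight E γ y ∂μ := by
          refine lintegral_mono_set ?_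
          rw [hb]
          apply ball_subset_ball'
          linarith
      _ ≤ C * ENNReal.ofReal (t x r) ^ (-γ) * μ (ball z (t x r)) := hA z hz _ (ht0 x r hr) hadm
      _ ≤ C * ENNReal.ofReal (t x r) ^ (-γ) * (M * μ (ball x r)) := by
          gcongr
          rw [hb]
          refine (measure_mono (ball_subset_ball' ?_)).trans (hM2 x r hr)
          rw [dist_comm]; linarith
      _ = _ := by ring

lemma avg_lower {μ : Measure X} (hballs : BallsPosFinite μ) (hdbl : Doubling μ) {E : Set X}
    (hE : E.Nonempty) (hpor : IsPorous E) (γ : ℝ) :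
    ∃ K : ℝ≥0∞, K ≠ ∞ ∧ ∀ x ∈ E, ∀ r, 0 < r → Adm X r →
      ENNReal.ofReal r ^ (-γ) ≤
        K * ((∫⁻ y in ball x r, distWeight E γ y ∂μ) / μ (ball x r)) := by
  obtain ⟨c, hc0, hc1, M, hM, hH⟩ := exists_hole hdbl hE hpor
  refine ⟨M * ENNReal.ofReal c⁻¹ ^ |-γ|, ?_, fun x hx r hr hadm => ?_⟩
  · exact ENNReal.mul_ne_top hM (ofReal_rpow_ne (by positivity) _).2
  obtain ⟨H, hHm, hHs, hHd, hHμ⟩ := hH x hx r hr hadm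
  obtain ⟨p1, p2⟩ := hballs x r hr
  rw [← mul_div_assoc, ENNReal.le_div_iff_mul_le (Or.inl p1.ne') (Or.inl p2.ne)]
  have hc1' : 1 ≤ c⁻¹ := (one_le_inv₀ hc0).2 (by linarith)
  calc ENNReal.ofReal r ^ (-γ) * μ (ball x r)
      ≤ ENNReal.ofReal r ^ (-γ) * (M * μ H) := by
        refine mul_le_mul' le_rfl (le_trans (measure_mono (ball_subset_ball (by linarith))) hHμ)
    _ = M * (ENNReal.ofReal r ^ (-γ) * μ H) := by ring
    _ ≤ M * ∫⁻ y in H, ENNReal.ofReal c⁻¹ ^ |-γ| * distWeight E γ y ∂μ := by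
        rw [← setLIntegral_const]
        refine mul_le_mul' le_rfl (setLIntegral_mono' hHm fun y hy => ?_)
        have h1 := hHd y hy
        have h2 := infDist_lt_of_mem_ball hx (hHs hy)
        have h3 : 0 < c * r := by positivity
        refine rpow_comp hr (by linarith) (by positivity) ?_ ?_ _
        · rw [inv_mul_eq_div, le_div_iff₀ hc0]; linarith
        · nlinarith
    _ = M * ENNReal.ofReal c⁻¹ ^ |-γ| * ∫⁻ y in H, distWeight E γ y ∂μ := by
        rw [lintegral_const_mul _ (measurable_distWeight E γ), mul_assoc]
    _ ≤ _ := mul_le_mul' le_rfl (lintegral_mono_set hHs)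

lemma distWeight_rpow (E : Set X) (α s : ℝ) (y : X) :
    distWeight E α y ^ s = distWeight E (α * s) y := by
  unfold distWeight
  rw [← ENNReal.rpow_mul]
  congr 1; ring

lemma codim_pos_mem [Nontrivial X] {μ : Measure X} (hballs : BallsPosFinite μ) (hdbl : Doubling μ)
    {E : Set X} (hE : E.Nonempty) (hpor : IsPorous E) : ∃ ρ ∈ assouadCodimBddSet μ E, 0 < ρ :=
  self_improve hballs hdbl hE hpor le_rfl (aik_of_nonpos μ E le_rfl)

lemma aik_iff [Nontrivial X] {μ : Measure X} (hballs : BallsPosFinite μ) (hdbl : Doubling μ)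
    {E : Set X} (hE : E.Nonempty) (hEc : IsClosed E) (hpor : IsPorous E) (α : ℝ) :
    Aik μ E α ↔ α < assouadCodim μ E := by
  have hbdd := bddAbove_bddSet hballs hdbl hE
  constructor
  · intro h
    obtain ⟨ρ, hρ, hlt⟩ : ∃ ρ ∈ assouadCodimBddSet μ E, α < ρ := by
      rcases le_or_gt 0 α with h0 | h0
      · exact self_improve hballs hdbl hE hpor h0 h
      · exact ⟨0, zero_mem_bddSet μ E, h0⟩
    exact lt_of_lt_of_le hlt (le_csSup hbdd hρ)
  · intro h
    rcases le_or_gt α 0 with h0 | h0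
    · exact aik_of_nonpos μ E h0
    · obtain ⟨ρ, hρ, hlt⟩ := exists_lt_of_lt_csSup ⟨0, zero_mem_bddSet μ E⟩ h
      exact aik_of_mem hballs hE hEc h0.le hlt hρ

lemma ap_iff [Nontrivial X] {μ : Measure X} (hballs : BallsPosFinite μ) (hdbl : Doubling μ)
    {E : Set X} (hE : E.Nonempty) (hEc : IsClosed E) (hpor : IsPorous E)
    (α p : ℝ) (hp : 1 < p) :
    MemAp μ (distWeight E α) p ↔ Aik μ E α ∧ Aik μ E (α * (-(1 / (p - 1)))) := by
  have hp1 : 0 < p - 1 := by linarith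
  set β := α * (-(1 / (p - 1))) with hβ
  have hβα : β * (p - 1) = -α := by rw [hβ]; field_simp
  unfold MemAp
  simp only [distWeight_rpow]
  rw [← hβ]
  constructor
  · rintro ⟨-, A, hA0, hA⟩
    constructor
    · obtain ⟨K, hK, hl⟩ := avg_lower hballs hdbl hE hpor β
      refine ⟨K ^ (p - 1) * ENNReal.ofReal A, ENNReal.mul_ne_top
        (ENNReal.rpow_ne_top_of_nonneg hp1.le hK) ENNReal.ofReal_ne_top, fun x hx r hr hadm => ?_⟩
      obtain ⟨p1, p2⟩ := hballs x r hr
      have h1 := hl x hx r hr hadm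
      have h2 := hA x r hr
      rw [← ENNReal.div_le_iff p1.ne' p2.ne]
      set I := (∫⁻ y in ball x r, distWeight E α y ∂μ) / μ (ball x r)
      set J := (∫⁻ y in ball x r, distWeight E β y ∂μ) / μ (ball x r)
      have h3 : ENNReal.ofReal r ^ α ≤ K ^ (p - 1) * J ^ (p - 1) := by
        rw [← ENNReal.mul_rpow_of_nonneg _ _ hp1.le]
        refine le_trans (le_of_eq ?_) (ENNReal.rpow_le_rpow h1 hp1.le)
        rw [← ENNReal.rpow_mul, neg_mul, hβα, neg_neg]
      calc I = I * ENNReal.ofReal r ^ α * ENNReal.ofReal r ^ (-α) := by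
            rw [mul_assoc, ENNReal.ofReal_rpow_of_pos hr, ENNReal.ofReal_rpow_of_pos hr,
              ← ENNReal.ofReal_mul (by positivity), ← Real.rpow_add hr]
            simp
        _ ≤ I * (K ^ (p - 1) * J ^ (p - 1)) * ENNReal.ofReal r ^ (-α) := by gcongr
        _ = K ^ (p - 1) * (I * J ^ (p - 1)) * ENNReal.ofReal r ^ (-α) := by ring
        _ ≤ _ := by gcongr
    · obtain ⟨K, hK, hl⟩ := avg_lower hballs hdbl hE hpor α
      refine ⟨(K * ENNReal.ofReal A) ^ (1 / (p - 1)), ENNReal.rpow_ne_top_of_nonneg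
        (by positivity) (ENNReal.mul_ne_top hK ENNReal.ofReal_ne_top), fun x hx r hr hadm => ?_⟩
      obtain ⟨p1, p2⟩ := hballs x r hr
      have h1 := hl x hx r hr hadm
      have h2 := hA x r hr
      rw [← ENNReal.div_le_iff p1.ne' p2.ne]
      set I := (∫⁻ y in ball x r, distWeight E α y ∂μ) / μ (ball x r)
      set J := (∫⁻ y in ball x r, distWeight E β y ∂μ) / μ (ball x r)
      have h3 : J ^ (p - 1) ≤ (K * ENNReal.ofReal A) * ENNReal.ofReal r ^ α := by
        calc J ^ (p - 1) = ENNReal.ofReal r ^ (-α) * J ^ (p - 1) * ENNReal.ofReal r ^ α := by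
              rw [mul_right_comm, ENNReal.ofReal_rpow_of_pos hr, ENNReal.ofReal_rpow_of_pos hr,
                ← ENNReal.ofReal_mul (by positivity), ← Real.rpow_add hr]
              simp
          _ ≤ (K * I) * J ^ (p - 1) * ENNReal.ofReal r ^ α := by gcongr
          _ = K * (I * J ^ (p - 1)) * ENNReal.ofReal r ^ α := by ring
          _ ≤ _ := by gcongr
      have h4 := ENNReal.rpow_le_rpow h3 (z := 1 / (p - 1)) (by positivity)
      rw [← ENNReal.rpow_mul, mul_one_div_cancel hp1.ne', ENNReal.rpow_one,
        ENNReal.mul_rpow_of_nonneg _ _ (by positivity), ← ENNReal.rpow_mul] at h4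
      rwa [show -β = α * (1 / (p - 1)) by rw [hβ]; ring]
  · rintro ⟨hα, hβA⟩
    obtain ⟨t, ht0, ht⟩ := avg_upper μ hballs hdbl hE
    obtain ⟨K, hK, hI⟩ := ht α hα
    obtain ⟨K', hK', hJ⟩ := ht β hβA
    obtain ⟨ρ, hρ, hρ0⟩ := codim_pos_mem hballs hdbl hE hpor
    have hnull := null_of_mem hballs hE hρ0 hρ
    refine ⟨⟨measurable_distWeight E α, ?_, ?_⟩, ?_⟩
    · have : ∀ᵐ y ∂μ, y ∉ E := measure_eq_zero_iff_ae_notMem.1 hnull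
      filter_upwards [this] with y hy
      have hpos : 0 < infDist y E := (hEc.notMem_iff_infDist_pos hE).1 hy
      have := ofReal_rpow_ne hpos (-α)
      exact ⟨pos_iff_ne_zero.2 this.1, this.2⟩
    · intro x r hr htop
      obtain ⟨p1, p2⟩ := hballs x r hr
      have h := hI x r hr
      rw [htop, ENNReal.top_div_of_ne_top p2.ne, top_le_iff] at h
      exact ENNReal.mul_ne_top hK (ofReal_rpow_ne (ht0 x r hr) _).2 h
    · have hQ : K * K' ^ (p - 1) ≠ ∞ :=
        ENNReal.mul_ne_top hK (ENNReal.rpow_ne_top_of_nonneg hp1.le hK')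
      refine ⟨(K * K' ^ (p - 1)).toReal + 1, by positivity, fun x r hr => ?_⟩
      have e : ENNReal.ofReal (t x r) ^ (-α) * ENNReal.ofReal (t x r) ^ α = 1 := by
        rw [ENNReal.ofReal_rpow_of_pos (ht0 x r hr), ENNReal.ofReal_rpow_of_pos (ht0 x r hr),
          ← ENNReal.ofReal_mul (Real.rpow_nonneg (ht0 x r hr).le _), ← Real.rpow_add (ht0 x r hr)]
        simp
      refine (mul_le_mul' (hI x r hr) (ENNReal.rpow_le_rpow (hJ x r hr) hp1.le)).trans ?_
      calc K * ENNReal.ofReal (t x r) ^ (-α) * (K' * ENNReal.ofReal (t x r) ^ (-β)) ^ (p - 1)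
          = K * K' ^ (p - 1) * (ENNReal.ofReal (t x r) ^ (-α) * ENNReal.ofReal (t x r) ^ α) := by
            rw [ENNReal.mul_rpow_of_nonneg _ _ hp1.le, ← ENNReal.rpow_mul, neg_mul, hβα, neg_neg]
            ring
        _ = ENNReal.ofReal ((K * K' ^ (p - 1)).toReal) := by
            rw [e, mul_one, ENNReal.ofReal_toReal hQ]
        _ ≤ _ := ENNReal.ofReal_le_ofReal (by linarith)

theorem distWeight_memAp_iff_of_porous [Nontrivial X]
    (μ : Measure X) (hballs : BallsPosFinite μ) (hdbl : Doubling μ)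
    (E : Set X) (hE : E.Nonempty) (hEc : IsClosed E) (hpor : IsPorous E)
    (α p : ℝ) (hp : 1 < p) :
    MemAp μ (distWeight E α) p ↔
      (1 - p) * assouadCodim μ E < α ∧ α < assouadCodim μ E := by
  rw [ap_iff hballs hdbl hE hEc hpor α p hp, aik_iff hballs hdbl hE hEc hpor,
    aik_iff hballs hdbl hE hEc hpor, and_comm]
  have hp1 : 0 < p - 1 := by linarith
  have : α * (-(1 / (p - 1))) < assouadCodim μ E ↔ (1 - p) * assouadCodim μ E < α := by
    rw [show α * (-(1 / (p - 1))) = -α / (p - 1) by ring, div_lt_iff₀ hp1]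
    constructor <;> intro h <;> nlinarith
  rw [this]

end
end ApDistance
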